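/- For every natural number n and every natural number d ≥ 1, there are only finitely many isometry classes of even lattices L of rank n whose discriminant group L*/L has order d. -/

import Mathlib

open scoped BigOperators

noncomputable section

/-- The group `ℚ/ℤ`. -/
abbrev QmodZ : Type := ℚ ⧸ AddSubgroup.zmultiples (1 : ℚ)

/-- The group `ℚ/2ℤ`. -/
abbrev Qmod2Z : Type := ℚ ⧸ AddSubgroup.zmultiples (2 : ℚ)

/-- The isomorphism `ℚ/2ℤ → ℚ/ℤ` induced by dividing by `2`. -/
noncomputable def halfHom : Qmod2Z →+ QmodZ :=
  QuotientAddGroup.map _ _ (AddMonoidHom.mk' (fun x : ℚ => x / 2) (fun a b => add_div a b 2))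
    (by
      intro x hx
      obtain ⟨k, rfl⟩ := AddSubgroup.mem_zmultiples_iff.mp hx
      refine AddSubgroup.mem_zmultiples_iff.mpr ⟨k, ?_⟩
      show k • (1:ℚ) = (k • (2:ℚ)) / 2
      push_cast [zsmul_eq_mul]
      ring)

/-- The bilinear form `b(x,y) = (q(x+y) - q(x) - q(y))/2 ∈ ℚ/ℤ` associated to
`q : A → ℚ/2ℤ`. -/
def bForm {A : Type*} [AddCommGroup A] (q : A → Qmod2Z) (x y : A) : QmodZ :=
  halfHom (q (x + y) - q x - q y)

/-- `q : A → ℚ/2ℤ` is a finite quadratic space structure on the finite abelian group `A`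
if the associated form `b` is `ℤ`-bilinear (i.e. biadditive) and nondegenerate. -/
structure IsFiniteQuadraticSpace {A : Type*} [AddCommGroup A] [Finite A]
    (q : A → Qmod2Z) : Prop where
  add_left : ∀ x x' y, bForm q (x + x') y = bForm q x y + bForm q x' y
  add_right : ∀ x y y', bForm q x (y + y') = bForm q x y + bForm q x y'
  nondeg : ∀ x, (∀ y, bForm q x y = 0) → x = 0

/-- Two quadratic forms are isometric if some group isomorphism carries one to the other. -/
def FQSIsometric {A B : Type*} [AddCommGroup A] [AddCommGroup B]
    (qA : A → Qmod2Z) (qB : B → Qmod2Z) : Prop :=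
  ∃ e : A ≃+ B, ∀ x, qB (e x) = qA x

/-- An even lattice, given by its rank and Gram matrix: the Gram matrix is symmetric,
has even diagonal (so `(x,x)` is always even) and is nondegenerate. -/
structure EvenLattice : Type where
  n : ℕ
  B : Matrix (Fin n) (Fin n) ℤ
  symm : B.IsSymm
  even_diag : ∀ i, 2 ∣ B i i
  nondeg : B.det ≠ 0

/-- The bilinear form of `L` extended to `R^n` for any commutative ring `R ⊇ ℤ`. -/
def formR (L : EvenLattice) (R : Type*) [CommRing R] (x y : Fin L.n → R) : R :=
  ∑ i, ∑ j, (L.B i j : R) * x i * y j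

theorem formR_zero_left (L : EvenLattice) (R : Type*) [CommRing R] (y : Fin L.n → R) :
    formR L R 0 y = 0 := by
  simp [formR]

theorem formR_add_left (L : EvenLattice) (R : Type*) [CommRing R] (x x' y : Fin L.n → R) :
    formR L R (x + x') y = formR L R x y + formR L R x' y := by
  simp [formR, mul_add, add_mul, Finset.sum_add_distrib]

theorem formR_neg_left (L : EvenLattice) (R : Type*) [CommRing R] (x y : Fin L.n → R) :
    formR L R (-x) y = -formR L R x y := by
  simp [formR, Finset.sum_neg_distrib]

/-- `L` and `M` are isometric over `R`. -/
def IsometricOver (R : Type*) [CommRing R] (L M : EvenLattice) : Prop :=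
  ∃ e : (Fin L.n → R) ≃ₗ[R] (Fin M.n → R), ∀ x y, formR M R (e x) (e y) = formR L R x y

/-- `L` and `M` lie in the same genus: they are isometric over `ℤ_p` for all primes `p`
and over `ℝ`. -/
def SameGenus (L M : EvenLattice) : Prop :=
  (∀ (p : ℕ) [Fact p.Prime], IsometricOver ℤ_[p] L M) ∧ IsometricOver ℝ L M

/-- The subgroup of integral vectors in `ℚ^n`, i.e. the lattice `L` itself inside `L ⊗ ℚ`. -/
def intSub (L : EvenLattice) : AddSubgroup (Fin L.n → ℚ) where
  carrier := {x | ∀ i, ∃ m : ℤ, x i = m}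
  zero_mem' := fun i => ⟨0, by simp⟩
  add_mem' := by
    intro x y hx hy i
    obtain ⟨mx, hmx⟩ := hx i
    obtain ⟨my, hmy⟩ := hy i
    exact ⟨mx + my, by simp [hmx, hmy]⟩
  neg_mem' := by
    intro x hx i
    obtain ⟨m, hm⟩ := hx i
    exact ⟨-m, by simp [hm]⟩

/-- The dual lattice of a subgroup `K` of `L ⊗ ℚ`:
all vectors pairing integrally with every element of `K`. -/
def dualOf (L : EvenLattice) (K : AddSubgroup (Fin L.n → ℚ)) : AddSubgroup (Fin L.n → ℚ) where
  carrier := {x | ∀ y ∈ K, ∃ m : ℤ, formR L ℚ x y = m}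
  zero_mem' := fun y _ => ⟨0, by simp [formR_zero_left]⟩
  add_mem' := by
    intro x x' hx hx' y hy
    obtain ⟨m, hm⟩ := hx y hy
    obtain ⟨m', hm'⟩ := hx' y hy
    exact ⟨m + m', by rw [formR_add_left, hm, hm']; push_cast; ring⟩
  neg_mem' := by
    intro x hx y hy
    obtain ⟨m, hm⟩ := hx y hy
    exact ⟨-m, by rw [formR_neg_left, hm]; push_cast; ring⟩

/-- The dual lattice `L^*` of `L`. -/
abbrev dualSub (L : EvenLattice) : AddSubgroup (Fin L.n → ℚ) := dualOf L (intSub L)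

/-- The discriminant group `K^*/K` of a subgroup `K` of `L ⊗ ℚ`. -/
abbrev discGroupOf (L : EvenLattice) (K : AddSubgroup (Fin L.n → ℚ)) : Type :=
  dualOf L K ⧸ K.addSubgroupOf (dualOf L K)

/-- The discriminant group `L^*/L`. -/
abbrev discGroup (L : EvenLattice) : Type := discGroupOf L (intSub L)

/-- The discriminant form on `K^*/K`, `q(x + K) = (x,x) mod 2ℤ`
(defined via a choice of representative; it is independent of this choice). -/
noncomputable def discQOf (L : EvenLattice) (K : AddSubgroup (Fin L.n → ℚ)) :
    discGroupOf L K → Qmod2Z :=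
  fun a => (QuotientAddGroup.mk (formR L ℚ (a.out : Fin L.n → ℚ) (a.out : Fin L.n → ℚ)) : Qmod2Z)

/-- The discriminant form `q_L` on `L^*/L`. -/
noncomputable def discQ (L : EvenLattice) : discGroup L → Qmod2Z := discQOf L (intSub L)

/-- `n₊`: the maximal dimension of a positive definite subspace of `L ⊗ ℝ`. -/
noncomputable def sigPlus (L : EvenLattice) : ℕ :=
  sSup {d : ℕ | ∃ W : Submodule ℝ (Fin L.n → ℝ), Module.finrank ℝ W = d ∧
    ∀ x ∈ W, x ≠ 0 → 0 < formR L ℝ x x}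

/-- `n₋`: the maximal dimension of a negative definite subspace of `L ⊗ ℝ`. -/
noncomputable def sigMinus (L : EvenLattice) : ℕ :=
  sSup {d : ℕ | ∃ W : Submodule ℝ (Fin L.n → ℝ), Module.finrank ℝ W = d ∧
    ∀ x ∈ W, x ≠ 0 → formR L ℝ x x < 0}

end

section LatHelpers

open Matrix

theorem prim_exists {n : ℕ} (x : Fin n → ℤ) (hx : x ≠ 0) :
    ∃ (g : ℤ) (x' u : Fin n → ℤ), g ≠ 0 ∧ x = g • x' ∧ u ⬝ᵥ x' = 1 := by
  obtain ⟨g, hg⟩ := (inferInstance : (Ideal.span (Set.range x)).IsPrincipal).principal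
  have hd : ∀ i, ∃ c, x i = g * c := fun i => by
    have : x i ∈ Ideal.span (Set.range x) := Ideal.subset_span ⟨i, rfl⟩
    rw [hg] at this
    exact Ideal.mem_span_singleton.1 this
  choose x' hx' using hd
  have hgm : g ∈ Ideal.span (Set.range x) := by
    rw [hg]; exact Ideal.mem_span_singleton_self g
  obtain ⟨u, hu⟩ := (Ideal.mem_span_range_iff_exists_fun).1 hgm
  have hg0 : g ≠ 0 := by
    rintro rfl
    apply hx; ext i; simp [hx']
  refine ⟨g, x', u, hg0, ?_, ?_⟩
  · ext i; simp [hx']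
  · apply mul_left_cancel₀ hg0
    rw [mul_one]
    conv_rhs => rw [← hu]
    simp only [dotProduct, Finset.mul_sum, hx']
    exact Finset.sum_congr rfl fun i _ => by ring

theorem extend_prim {n : ℕ} (x u : Fin (n+1) → ℤ) (h : u ⬝ᵥ x = 1) :
    ∃ U : Matrix (Fin (n+1)) (Fin (n+1)) ℤ, IsUnit U.det ∧ ∀ i, U i 0 = x i := by
  let φ : (Fin (n+1) → ℤ) →ₗ[ℤ] ℤ := dotProductBilin ℤ ℤ u
  have hφ : ∀ z, φ z = u ⬝ᵥ z := fun z => rfl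
  obtain ⟨m, b⟩ := Submodule.basisOfPid (Pi.basisFun ℤ (Fin (n+1))) (LinearMap.ker φ)
  let B := Module.Basis.mkFinCons x b
    (by
      intro c z hz h0
      have := congrArg φ h0
      rw [map_add, map_smul, LinearMap.mem_ker.1 hz, hφ, h] at this
      simpa using this)
    (by
      intro z
      refine ⟨-(φ z), ?_⟩
      rw [LinearMap.mem_ker, map_add, map_smul, hφ x, h]; simp)
  have hm : m = n := by
    have h1 := Module.finrank_eq_card_basis B
    simpa using h1.symm
  subst hm
  refine ⟨(Pi.basisFun ℤ (Fin (m+1))).toMatrix B, ?_, ?_⟩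
  · have := (Pi.basisFun ℤ (Fin (m+1))).toMatrix_mul_toMatrix_flip B
    exact IsUnit.of_mul_eq_one _ (by rw [← det_mul, this, det_one])
  · intro i
    simp [Module.Basis.toMatrix_apply, B]

def bil {n : ℕ} (B : Matrix (Fin n) (Fin n) ℤ) (x y : Fin n → ℤ) : ℤ := x ⬝ᵥ B *ᵥ y

theorem bil_cong {n : ℕ} (B U : Matrix (Fin n) (Fin n) ℤ) (x y : Fin n → ℤ) :
    bil (Uᵀ * B * U) x y = bil B (U *ᵥ x) (U *ᵥ y) := by
  simp only [bil, ← mulVec_mulVec]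
  rw [mulVec_transpose, dotProduct_comm, ← dotProduct_mulVec, dotProduct_comm]

theorem cong_apply {n : ℕ} (B U : Matrix (Fin n) (Fin n) ℤ) (i j : Fin n) :
    (Uᵀ * B * U) i j = bil B (fun k => U k i) (fun k => U k j) := by
  rw [Matrix.mul_assoc]
  rfl

theorem bil_comm {n : ℕ} (B : Matrix (Fin n) (Fin n) ℤ) (hB : B.IsSymm) (x y : Fin n → ℤ) :
    bil B x y = bil B y x := by
  unfold bil
  rw [dotProduct_mulVec, dotProduct_comm, ← mulVec_transpose, hB.eq]

theorem bil_add_right {n : ℕ} (B : Matrix (Fin n) (Fin n) ℤ) (x y z : Fin n → ℤ) :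
    bil B x (y + z) = bil B x y + bil B x z := by
  simp [bil, mulVec_add]

theorem bil_smul_right {n : ℕ} (B : Matrix (Fin n) (Fin n) ℤ) (c : ℤ) (x y : Fin n → ℤ) :
    bil B x (c • y) = c * bil B x y := by
  rw [bil, mulVec_smul, dotProduct_smul, smul_eq_mul, bil]

theorem bil_add_left {n : ℕ} (B : Matrix (Fin n) (Fin n) ℤ) (x y z : Fin n → ℤ) :
    bil B (x + y) z = bil B x z + bil B y z := by
  simp [bil]

theorem bil_smul_left {n : ℕ} (B : Matrix (Fin n) (Fin n) ℤ) (c : ℤ) (x y : Fin n → ℤ) :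
    bil B (c • x) y = c * bil B x y := by
  rw [bil, smul_dotProduct, smul_eq_mul, bil]

def schur {n : ℕ} (B : Matrix (Fin (n+1)) (Fin (n+1)) ℤ) : Matrix (Fin n) (Fin n) ℤ :=
  of fun i j => B 0 0 * B i.succ j.succ - B 0 i.succ * B 0 j.succ

def bvec {n : ℕ} (B : Matrix (Fin (n+1)) (Fin (n+1)) ℤ) : Fin n → ℤ := fun i => B 0 i.succ

theorem bil_schur {n : ℕ} (B : Matrix (Fin (n+1)) (Fin (n+1)) ℤ) (hB : B.IsSymm)
    (s t : ℤ) (x y : Fin n → ℤ) :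
    B 0 0 * bil B (Fin.cons s x) (Fin.cons t y) =
      (B 0 0 * s + bvec B ⬝ᵥ x) * (B 0 0 * t + bvec B ⬝ᵥ y) + bil (schur B) x y := by
  have hs : ∀ i : Fin n, B i.succ 0 = B 0 i.succ := fun i => hB.apply 0 i.succ
  have h1 : bil (schur B) x y = B 0 0 * (∑ i, x i * ∑ j, B i.succ j.succ * y j)
      - (bvec B ⬝ᵥ x) * (bvec B ⬝ᵥ y) := by
    rw [dotProduct, dotProduct, Finset.sum_mul_sum, Finset.mul_sum, ← Finset.sum_sub_distrib,
      bil, dotProduct]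
    refine Finset.sum_congr rfl fun i _ => ?_
    simp only [schur, bvec, dotProduct, mulVec, of_apply, Finset.mul_sum,
      ← Finset.sum_sub_distrib]
    exact Finset.sum_congr rfl fun j _ => by ring
  rw [h1]
  simp only [bil, dotProduct, mulVec, Fin.sum_univ_succ, Fin.cons_zero, Fin.cons_succ, hs, mul_add,
    Finset.sum_add_distrib, bvec]
  have h2 : ∑ i, x i * (B 0 i.succ * t) = (∑ i, B 0 i.succ * x i) * t := by
    rw [Finset.sum_mul]; exact Finset.sum_congr rfl fun i _ => by ring
  rw [h2]
  ring

theorem schur_det {n : ℕ} (B : Matrix (Fin (n+1)) (Fin (n+1)) ℤ) (hB : B.IsSymm) :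
    B 0 0 * (schur B).det = (B 0 0)^n * B.det := by
  have hs : ∀ i : Fin n, B i.succ 0 = B 0 i.succ := fun i => hB.apply 0 i.succ
  let e : Unit ⊕ Fin n ≃ Fin (n+1) :=
    ((Equiv.sumComm _ _).trans (Equiv.optionEquivSumPUnit (Fin n)).symm).trans (finSuccEquiv n).symm
  have e0 : e (Sum.inl ()) = 0 := by simp [e]
  have e1 : ∀ i, e (Sum.inr i) = i.succ := by intro i; simp [e]
  have h1 : B.submatrix e e = fromBlocks (of fun _ _ => B 0 0) (of fun _ j => B 0 j.succ)
      (of fun i _ => B 0 i.succ) (of fun i j => B i.succ j.succ) := by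
    ext (i|i) (j|j) <;> simp [e0, e1, hs]
  have h2 : (fromBlocks 1 0 (of fun i _ => - B 0 i.succ) (diagonal fun _ => B 0 0) :
        Matrix (Unit ⊕ Fin n) (Unit ⊕ Fin n) ℤ) * B.submatrix e e =
      fromBlocks (of fun _ _ => B 0 0) (of fun _ j => B 0 j.succ) 0 (schur B) := by
    rw [h1, fromBlocks_multiply]
    congr 1
    · simp
    · simp
    · ext i j; simp [mul_apply, diagonal_apply]; ring
    · ext i j; simp [mul_apply, schur, diagonal_apply]; ring
  have h3 := congrArg det h2
  rw [det_mul, det_fromBlocks_zero₁₂, det_fromBlocks_zero₂₁, det_submatrix_equiv_self] at h3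
  simpa using h3.symm

theorem min_vec {n : ℕ} (B : Matrix (Fin n) (Fin n) ℤ) (h : ∃ x, bil B x x ≠ 0) :
    ∃ x, bil B x x ≠ 0 ∧ (∀ z, bil B z z ≠ 0 → |bil B x x| ≤ |bil B z z|) ∧
      ∃ u, u ⬝ᵥ x = 1 := by
  obtain ⟨x, hx, hm⟩ := (measure fun x => (bil B x x).natAbs).wf.has_min {x | bil B x x ≠ 0} h
  have hm' : ∀ z, bil B z z ≠ 0 → |bil B x x| ≤ |bil B z z| := by
    intro z hz
    have := hm z hz
    have h2 : (bil B x x).natAbs ≤ (bil B z z).natAbs := not_lt.1 this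
    rw [Int.abs_eq_natAbs, Int.abs_eq_natAbs]
    exact_mod_cast h2
  have hx0 : x ≠ 0 := by
    rintro rfl
    exact hx (by simp [bil])
  obtain ⟨g, x', u, hg, rfl, hu⟩ := prim_exists x hx0
  have he : bil B (g • x') (g • x') = g ^ 2 * bil B x' x' := by
    rw [bil_smul_left, bil_smul_right]; ring
  have hx' : bil B x' x' ≠ 0 := fun h0 => hx (by rw [he, h0, mul_zero])
  refine ⟨x', hx', fun z hz => ?_, u, hu⟩
  refine le_trans ?_ (hm' z hz)
  rw [he, abs_mul]
  have : 1 ≤ |g ^ 2| := Int.one_le_abs (pow_ne_zero _ hg)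
  nlinarith [abs_nonneg (bil B x' x')]

theorem red_exists (a c : ℤ) (ha : a ≠ 0) : ∃ t : ℤ, 2 * |a * t + c| ≤ |a| := by
  refine ⟨-(Int.sign a * c.bdiv a.natAbs), ?_⟩
  have h1 := Int.bmod_add_bdiv c a.natAbs
  have hpos : 0 < a.natAbs := Int.natAbs_pos.2 ha
  have h2 := Int.le_bmod (x := c) hpos
  have h3 := Int.bmod_le (x := c) hpos
  have h4 : a * -(Int.sign a * c.bdiv a.natAbs) + c = c.bmod a.natAbs := by
    have : a * Int.sign a = a.natAbs := by rw [mul_comm]; exact Int.sign_mul_self_eq_natAbs a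
    linear_combination -h1 - c.bdiv a.natAbs * this
  rw [h4, Int.abs_eq_natAbs a]
  rcases abs_cases (c.bmod a.natAbs) with h | h <;> omega

theorem cong_symm {n : ℕ} {B : Matrix (Fin n) (Fin n) ℤ} (hB : B.IsSymm)
    (U : Matrix (Fin n) (Fin n) ℤ) : (Uᵀ * B * U).IsSymm := by
  rw [IsSymm, transpose_mul, transpose_mul, transpose_transpose, hB.eq, Matrix.mul_assoc]

theorem cong_det {n : ℕ} (B U : Matrix (Fin n) (Fin n) ℤ) (hU : IsUnit U.det) :
    (Uᵀ * B * U).det = B.det := by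
  rw [det_mul, det_mul, det_transpose]
  have : U.det * U.det = 1 := Int.isUnit_mul_self hU
  linear_combination B.det * this

theorem mulVec_ne_zero_of_unit {n : ℕ} (U : Matrix (Fin n) (Fin n) ℤ) (hU : IsUnit U.det)
    (x : Fin n → ℤ) (hx : x ≠ 0) : U *ᵥ x ≠ 0 := by
  intro h
  apply hx
  have := congrArg (fun v => U⁻¹ *ᵥ v) h
  simpa [nonsing_inv_mul U hU] using this

theorem mulVec_surj_of_unit {n : ℕ} (U : Matrix (Fin n) (Fin n) ℤ) (hU : IsUnit U.det)
    (x : Fin n → ℤ) : U *ᵥ (U⁻¹ *ᵥ x) = x := by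
  simp [mul_nonsing_inv U hU]

theorem hermite (n : ℕ) : ∃ c : ℤ, 0 ≤ c ∧ ∀ B : Matrix (Fin (n+1)) (Fin (n+1)) ℤ, B.IsSymm →
    (∀ x, x ≠ 0 → bil B x x ≠ 0) → ∃ x, x ≠ 0 ∧ |bil B x x| ^ (n+1) ≤ c * |B.det| := by
  induction n with
  | zero =>
    refine ⟨1, by norm_num, fun B _ _ => ⟨fun _ => 1, fun h => ?_, ?_⟩⟩
    · simpa using congrFun h 0
    · simp [bil, dotProduct, mulVec]
  | succ n ih =>
    obtain ⟨c, hc, ih⟩ := ih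
    refine ⟨4 ^ (n+1) * c, by positivity, fun B hB han => ?_⟩
    obtain ⟨x, hx, hmin, u, hu⟩ := min_vec B ⟨fun _ => 1, han _ (fun h => by
      simpa using congrFun h 0)⟩
    obtain ⟨U, hU, hUx⟩ := extend_prim x u hu
    obtain ⟨B', hB'⟩ : ∃ B', B' = Uᵀ * B * U := ⟨_, rfl⟩
    have hs : B'.IsSymm := hB' ▸ cong_symm hB U
    have hdet : B'.det = B.det := hB' ▸ cong_det B U hU
    have h00 : B' 0 0 = bil B x x := by
      rw [hB', cong_apply]; simp [hUx]
    have han' : ∀ z, z ≠ 0 → bil B' z z ≠ 0 := fun z hz => by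
      rw [hB', bil_cong]; exact han _ (mulVec_ne_zero_of_unit U hU z hz)
    have hmin' : ∀ z, z ≠ 0 → |B' 0 0| ≤ |bil B' z z| := fun z hz => by
      rw [h00, hB', bil_cong]
      exact hmin _ (han _ (mulVec_ne_zero_of_unit U hU z hz))
    have ha : B' 0 0 ≠ 0 := by rw [h00]; exact hx
    have hcons : ∀ (t : ℤ) (y : Fin (n+1) → ℤ), y ≠ 0 → (Fin.cons t y : Fin (n+2) → ℤ) ≠ 0 := by
      intro t y hy h
      apply hy
      ext i
      simpa using congrFun h i.succ
    have hSs : (schur B').IsSymm := by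
      ext i j
      simp only [schur, transpose_apply, of_apply, hs.apply i.succ j.succ]
      ring
    obtain ⟨y, hy, hyb⟩ := ih (schur B') hSs (by
      intro y hy h0
      have h1 := bil_schur B' hs (-(bvec B' ⬝ᵥ y)) (-(bvec B' ⬝ᵥ y)) (B' 0 0 • y) (B' 0 0 • y)
      rw [bil_smul_left, bil_smul_right, h0, dotProduct_smul, smul_eq_mul] at h1
      have h2 : B' 0 0 * bil B' (Fin.cons (-(bvec B' ⬝ᵥ y)) (B' 0 0 • y))
        (Fin.cons (-(bvec B' ⬝ᵥ y)) (B' 0 0 • y)) = 0 := by rw [h1]; ring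
      exact han' _ (hcons _ _ (smul_ne_zero ha hy)) ((mul_eq_zero.1 h2).resolve_left ha))
    obtain ⟨t, ht⟩ := red_exists (B' 0 0) (bvec B' ⬝ᵥ y) ha
    have h1 := bil_schur B' hs t t y y
    have h2 := hmin' _ (hcons t y hy)
    refine ⟨x, fun h => hx (by rw [h]; simp [bil]), ?_⟩
    rw [← h00, ← hdet]
    have h3 := schur_det B' hs
    generalize B' 0 0 = a at *
    generalize bil (schur B') y y = q at *
    generalize bil B' (Fin.cons t y) (Fin.cons t y) = f at *
    generalize a * t + bvec B' ⬝ᵥ y = r at *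
    generalize B'.det = D at *
    generalize (schur B').det = E at *
    have ha0 : 0 < |a| := abs_pos.2 ha
    have h4 : |a| * |f| ≤ |r| * |r| + |q| := by
      rw [← abs_mul, h1, ← abs_mul]; exact abs_add_le _ _
    have h5 : |a| ^ 2 ≤ 4 * |q| := by nlinarith [abs_nonneg r, abs_nonneg q]
    have h6 : (|a| ^ 2) ^ (n+1) ≤ 4 ^ (n+1) * (c * |E|) := by
      calc _ ≤ (4 * |q|) ^ (n+1) := pow_le_pow_left₀ (by positivity) h5 _
        _ = 4 ^ (n+1) * |q| ^ (n+1) := mul_pow _ _ _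
        _ ≤ _ := by gcongr
    have h7 : |a| * |E| = |a| ^ (n+1) * |D| := by
      rw [← abs_mul, h3, abs_mul, abs_pow]
    have h8 : |a| ^ (n+1) * |a| ^ (n+1+1) ≤ |a| ^ (n+1) * (4 ^ (n+1) * c * |D|) := by
      calc _ = |a| * (|a| ^ 2) ^ (n+1) := by ring
        _ ≤ |a| * (4 ^ (n+1) * (c * |E|)) := by gcongr
        _ = 4 ^ (n+1) * c * (|a| * |E|) := by ring
        _ = _ := by rw [h7]; ring
    exact le_of_mul_le_mul_left h8 (by positivity)

theorem small_value (n : ℕ) : ∃ c : ℤ, 0 ≤ c ∧ ∀ B : Matrix (Fin (n+1)) (Fin (n+1)) ℤ, B.IsSymm →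
    B.det ≠ 0 → ∃ x, bil B x x ≠ 0 ∧ |bil B x x| ≤ c * |B.det| := by
  obtain ⟨c, hc, h⟩ := hermite n
  refine ⟨c + 2, by positivity, fun B hB hdet => ?_⟩
  by_cases han : ∀ x, x ≠ 0 → bil B x x ≠ 0
  · obtain ⟨x, hx, hxb⟩ := h B hB han
    refine ⟨x, han x hx, ?_⟩
    have : |bil B x x| ≤ |bil B x x| ^ (n+1) :=
      le_self_pow₀ (Int.one_le_abs (han x hx)) (by omega)
    nlinarith [abs_nonneg B.det]
  · push Not at han
    obtain ⟨x, hx, hx0⟩ := han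
    obtain ⟨g, x', u, hg, rfl, hu⟩ := prim_exists x hx
    rw [bil_smul_left, bil_smul_right] at hx0
    have hx0' : bil B x' x' = 0 := by simpa [hg] using hx0
    have hy : bil B (u ᵥ* B.adjugate) x' = B.det := by
      rw [bil, ← dotProduct_mulVec, mulVec_mulVec, adjugate_mul, smul_mulVec, one_mulVec,
        dotProduct_smul, hu]; simp
    generalize u ᵥ* B.adjugate = y at hy
    obtain ⟨t, ht⟩ := red_exists (2 * B.det) (bil B y y) (by simpa using hdet)
    have hk : ∀ k : ℤ, bil B (y + k • x') (y + k • x') = bil B y y + 2 * B.det * k := by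
      intro k
      rw [bil_add_left, bil_add_right, bil_add_right, bil_smul_left, bil_smul_left,
        bil_smul_right, bil_smul_right, hx0', bil_comm B hB x' y, hy]
      ring
    rw [abs_mul 2] at ht
    have hD := abs_pos.2 hdet
    have h22 : |(2:ℤ)| = 2 := rfl
    rw [h22] at ht
    by_cases h0 : 2 * B.det * t + bil B y y = 0
    · refine ⟨y + (t+1) • x', ?_, ?_⟩
      · rw [hk]
        have : bil B y y + 2 * B.det * (t+1) = 2 * B.det := by linear_combination h0
        rw [this]; simpa using hdet
      · rw [hk]
        have : bil B y y + 2 * B.det * (t+1) = 2 * B.det := by linear_combination h0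
        rw [this, abs_mul, h22]
        nlinarith
    · refine ⟨y + t • x', ?_, ?_⟩
      · rw [hk, add_comm]; exact h0
      · rw [hk, add_comm]; nlinarith

theorem reduction (n : ℕ) : ∀ D : ℤ, ∃ K : ℤ, 0 ≤ K ∧ ∀ B : Matrix (Fin n) (Fin n) ℤ, B.IsSymm →
    B.det ≠ 0 → |B.det| ≤ D → ∃ U : Matrix (Fin n) (Fin n) ℤ, IsUnit U.det ∧
      ∀ i j, |(Uᵀ * B * U) i j| ≤ K := by
  induction n with
  | zero => exact fun D => ⟨0, le_rfl, fun B _ _ _ => ⟨1, by simp, fun i => i.elim0⟩⟩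
  | succ n ih =>
    intro D
    obtain ⟨c, hc, hsv⟩ := small_value n
    obtain ⟨K, hK, hred⟩ := ih ((c * |D|) ^ n * |D|)
    refine ⟨K + c * |D| + (c * |D|) * (c * |D|), by positivity, fun B hB hd hdD => ?_⟩
    obtain ⟨x₀, hx₀, hx₀b⟩ := hsv B hB hd
    obtain ⟨x, hx, hmin, u, hu⟩ := min_vec B ⟨x₀, hx₀⟩
    have hxb : |bil B x x| ≤ c * |D| := by
      refine (hmin _ hx₀).trans (hx₀b.trans ?_)
      exact mul_le_mul_of_nonneg_left (hdD.trans (le_abs_self D)) hc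
    obtain ⟨U, hU, hUx⟩ := extend_prim x u hu
    obtain ⟨B', hB'⟩ : ∃ B', B' = Uᵀ * B * U := ⟨_, rfl⟩
    have hs : B'.IsSymm := hB' ▸ cong_symm hB U
    have hdet : B'.det = B.det := hB' ▸ cong_det B U hU
    have h00 : B' 0 0 = bil B x x := by
      rw [hB', cong_apply]; simp [hUx]
    have ha : B' 0 0 ≠ 0 := by rw [h00]; exact hx
    have hSs : (schur B').IsSymm := by
      ext i j
      simp only [schur, transpose_apply, of_apply, hs.apply i.succ j.succ]
      ring
    have h3 := schur_det B' hs
    have ha1 : 1 ≤ |B' 0 0| := Int.one_le_abs ha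
    rw [← h00] at hxb
    have hSd : (schur B').det ≠ 0 := by
      intro h0
      rw [h0, mul_zero, hdet] at h3
      exact (mul_ne_zero (pow_ne_zero n ha) hd) h3.symm
    obtain ⟨V, hV, hVb⟩ := hred (schur B') hSs hSd (by
      calc |(schur B').det| ≤ |B' 0 0| * |(schur B').det| :=
            le_mul_of_one_le_left (abs_nonneg _) ha1
        _ = |B' 0 0| ^ n * |B.det| := by rw [← abs_mul, h3, abs_mul, abs_pow, hdet]
        _ ≤ _ := by
          exact mul_le_mul (pow_le_pow_left₀ (abs_nonneg _) hxb _) (hdD.trans (le_abs_self D))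
            (abs_nonneg _) (by positivity))
    have hT : ∀ j, ∃ t, 2 * |B' 0 0 * t + bvec B' ⬝ᵥ (fun k => V k j)| ≤ |B' 0 0| :=
      fun j => red_exists _ _ ha
    choose t ht using hT
    let W : Matrix (Fin (n+1)) (Fin (n+1)) ℤ :=
      of fun i j => (Fin.cons (Fin.cons 1 0) (fun j => Fin.cons (t j) (fun k => V k j)) :
        Fin (n+1) → Fin (n+1) → ℤ) j i
    have hW0 : (fun k => W k 0) = Fin.cons 1 0 := by ext k; simp [W]
    have hWs : ∀ j : Fin n, (fun k => W k j.succ) = Fin.cons (t j) (fun k => V k j) := by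
      intro j; ext k; simp [W]
    have hWd : W.det = V.det := by
      rw [det_succ_column_zero, Fin.sum_univ_succ]
      have e1 : W 0 0 = 1 := by simp [W]
      have e2 : ∀ i : Fin n, W i.succ 0 = 0 := by intro i; simp [W]
      have e3 : W.submatrix Fin.succ Fin.succ = V := by ext i j; simp [W]
      simp [e1, e2, e3]
    refine ⟨U * W, by rw [det_mul, hWd]; exact hU.mul hV, ?_⟩
    have heq : (U * W)ᵀ * B * (U * W) = Wᵀ * B' * W := by
      rw [hB', transpose_mul]; simp only [Matrix.mul_assoc]
    rw [heq]
    obtain ⟨B2, hB2⟩ : ∃ B2, B2 = Wᵀ * B' * W := ⟨_, rfl⟩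
    have hs2 : B2.IsSymm := hB2 ▸ cong_symm hs W
    rw [← hB2]
    have c00 : B2 0 0 = B' 0 0 := by
      apply mul_left_cancel₀ ha
      rw [hB2, cong_apply, hW0, bil_schur B' hs]; simp [bil]
    have c0s : ∀ j : Fin n, B2 0 j.succ = B' 0 0 * t j + bvec B' ⬝ᵥ (fun k => V k j) := by
      intro j
      apply mul_left_cancel₀ ha
      rw [hB2, cong_apply, hW0, hWs, bil_schur B' hs]; simp [bil]
    have css : ∀ i j : Fin n, B' 0 0 * B2 i.succ j.succ = B2 0 i.succ * B2 0 j.succ +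
        (Vᵀ * schur B' * V) i j := by
      intro i j
      rw [c0s, c0s, hB2, cong_apply, hWs, hWs, bil_schur B' hs, cong_apply]
    have b0s : ∀ j : Fin n, |B2 0 j.succ| ≤ c * |D| := by
      intro j
      have := ht j
      rw [← c0s] at this
      linarith [abs_nonneg (B2 0 j.succ)]
    have hcD : 0 ≤ c * |D| := by positivity
    intro i j
    refine Fin.cases ?_ (fun i => ?_) i <;> refine Fin.cases ?_ (fun j => ?_) j
    · rw [c00]; nlinarith
    · have := b0s j; nlinarith
    · have := b0s i; rw [hs2.apply]; nlinarith
    · calc |B2 i.succ j.succ| ≤ |B' 0 0| * |B2 i.succ j.succ| :=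
            le_mul_of_one_le_left (abs_nonneg _) ha1
        _ = |B2 0 i.succ * B2 0 j.succ + (Vᵀ * schur B' * V) i j| := by rw [← abs_mul, css]
        _ ≤ |B2 0 i.succ * B2 0 j.succ| + |(Vᵀ * schur B' * V) i j| := abs_add_le _ _
        _ ≤ (c * |D|) * (c * |D|) + K := by
          rw [abs_mul]
          exact add_le_add (mul_le_mul (b0s i) (b0s j) (abs_nonneg _) hcD) (hVb i j)
        _ ≤ _ := by linarith

theorem bil_even {n : ℕ} (B : Matrix (Fin n) (Fin n) ℤ) (hB : B.IsSymm) (h2 : ∀ i, 2 ∣ B i i)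
    (x : Fin n → ℤ) : 2 ∣ bil B x x := by
  have hsingle : ∀ i (c : ℤ), 2 ∣ bil B (Pi.single i c) (Pi.single i c) := by
    intro i c
    have : bil B (Pi.single i c) (Pi.single i c) = B i i * (c * c) := by
      simp [bil, single_dotProduct, mulVec_single]; ring
    rw [this]; exact Dvd.dvd.mul_right (h2 i) _
  have hx : x = ∑ i, Pi.single i (x i) := (Finset.univ_sum_single x).symm
  rw [hx]
  induction (Finset.univ : Finset (Fin n)) using Finset.induction_on with
  | empty => simp [bil]
  | insert i s hi ih =>
    rw [Finset.sum_insert hi, bil_add_left, bil_add_right, bil_add_right,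
      bil_comm B hB (∑ i ∈ s, _)]
    have := hsingle i (x i)
    omega

theorem formR_eq (L : EvenLattice) (R : Type*) [CommRing R] (x y : Fin L.n → R) :
    formR L R x y = x ⬝ᵥ (L.B.map (Int.cast : ℤ → R)) *ᵥ y := by
  simp only [formR, dotProduct, mulVec, Finset.mul_sum, map_apply]
  exact Finset.sum_congr rfl fun i _ => Finset.sum_congr rfl fun j _ => by ring

theorem det_le_of_card (M : EvenLattice) (d : ℕ) (hd : 1 ≤ d) (h : Nat.card (discGroup M) = d) :
    |M.B.det| ≤ (d : ℤ) ^ M.n := by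
  obtain ⟨Bq, hBq⟩ : ∃ Bq, Bq = M.B.map (Int.cast : ℤ → ℚ) := ⟨_, rfl⟩
  have hdet : Bq.det = (M.B.det : ℚ) := by
    rw [hBq]; exact (Int.cast_det M.B).symm
  have hu : IsUnit Bq.det := by
    rw [hdet, isUnit_iff_ne_zero]; exact_mod_cast M.nondeg
  have hsym : Bqᵀ = Bq := by
    rw [hBq, ← transpose_map, M.symm.eq]
  have hmem : ∀ j, Bq⁻¹ *ᵥ Pi.single j 1 ∈ dualSub M := by
    intro j y hy
    obtain ⟨m, hm⟩ := hy j
    refine ⟨m, ?_⟩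
    rw [formR_eq, ← hBq, dotProduct_mulVec, ← mulVec_transpose, hsym, mulVec_mulVec,
      mul_nonsing_inv _ hu, one_mulVec, single_dotProduct, one_mul, hm]
  have hint : ∀ i j, ∃ m : ℤ, (d : ℚ) * Bq⁻¹ i j = m := by
    intro i j
    have h0 : d • (QuotientAddGroup.mk ⟨_, hmem j⟩ : discGroup M) = 0 := by
      rw [← h]; exact card_nsmul_eq_zero'
    rw [← QuotientAddGroup.mk_nsmul, QuotientAddGroup.eq_zero_iff] at h0
    have h1 := (AddSubgroup.mem_addSubgroupOf.1 h0) i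
    simpa using h1
  choose N hN using hint
  have hprod : M.B * of N = diagonal fun _ => (d : ℤ) := by
    have : Bq * (of N).map (Int.cast : ℤ → ℚ) = diagonal fun _ => (d : ℚ) := by
      have h1 : (of N).map (Int.cast : ℤ → ℚ) = (d : ℚ) • Bq⁻¹ := by
        ext i j; simp [hN]
      rw [h1, Matrix.mul_smul, mul_nonsing_inv _ hu, smul_one_eq_diagonal]
    ext i j
    have h2 := congrFun (congrFun this i) j
    have h3 : ((M.B * of N) i j : ℚ) = (diagonal fun _ => (d : ℚ)) i j := by
      rw [← h2, hBq]; simp [mul_apply]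
    by_cases hij : i = j
    · subst hij; simp only [diagonal_apply_eq] at h3 ⊢; exact_mod_cast h3
    · simp only [diagonal_apply_ne _ hij] at h3 ⊢; exact_mod_cast h3
  have h4 := congrArg det hprod
  rw [det_mul, det_diagonal] at h4
  simp only [Finset.prod_const, Finset.card_univ, Fintype.card_fin] at h4
  exact Int.le_of_dvd (by positivity) ((abs_dvd _ _).2 (Dvd.intro _ h4))

theorem isom_of_cong {n : ℕ} (B B' U : Matrix (Fin n) (Fin n) ℤ) (hU : IsUnit U.det)
    (hB' : Uᵀ * B * U = B') (h1 h2 h3 h1' h2' h3') :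
    IsometricOver ℤ ⟨n, B, h1, h2, h3⟩ ⟨n, B', h1', h2', h3'⟩ := by
  subst hB'
  have i1 : U * U⁻¹ = 1 := mul_nonsing_inv U hU
  have i2 : U⁻¹ * U = 1 := nonsing_inv_mul U hU
  refine ⟨toLin'OfInv i1 i2, fun x y => ?_⟩
  have key : ∀ (C : Matrix (Fin n) (Fin n) ℤ) (k1 k2 k3) (x y : Fin n → ℤ),
      formR ⟨n, C, k1, k2, k3⟩ ℤ x y = bil C x y := by
    intro C k1 k2 k3 x y
    rw [formR_eq]
    simp [bil]
    rfl
  rw [key, key, bil_cong]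
  have e : ∀ x : Fin n → ℤ, U *ᵥ (toLin'OfInv i1 i2 x) = x := by
    intro x
    have : toLin'OfInv i1 i2 x = U⁻¹ *ᵥ x := rfl
    rw [this, mulVec_mulVec, i1, one_mulVec]
  erw [e, e]

end LatHelpers

/-- **Finiteness of lattices of bounded discriminant.** For fixed rank `n` and fixed
discriminant `d ≥ 1`, there are only finitely many isometry classes of even lattices of
rank `n` whose discriminant group has order `d`. -/
theorem finitely_many_even_lattices_of_fixed_discriminant (n d : ℕ) (hd : 1 ≤ d) :
    ∃ (k : ℕ) (reps : Fin k → EvenLattice),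
      ∀ M : EvenLattice, M.n = n → Nat.card (discGroup M) = d →
        ∃ i, IsometricOver ℤ M (reps i) := by
  obtain ⟨K, hK, hred⟩ := reduction n ((d : ℤ) ^ n)
  let T : Set (Matrix (Fin n) (Fin n) ℤ) :=
    {B | (B.IsSymm ∧ (∀ i, 2 ∣ B i i) ∧ B.det ≠ 0) ∧ ∀ i j, |B i j| ≤ K}
  have hfin : T.Finite := by
    have h1 : (Set.pi Set.univ fun _ : Fin n => Set.pi Set.univ fun _ : Fin n =>
        Set.Icc (-K) K).Finite :=
      Set.Finite.pi fun _ => Set.Finite.pi fun _ => Set.finite_Icc _ _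
    refine h1.subset fun B hB i _ j _ => ?_
    exact abs_le.1 (hB.2 i j)
  have : Finite T := hfin
  let e := Finite.equivFin T
  refine ⟨Nat.card T, fun i => ⟨n, (e.symm i).1, (e.symm i).2.1.1, (e.symm i).2.1.2.1,
    (e.symm i).2.1.2.2⟩, fun M hM hcard => ?_⟩
  have hdet := det_le_of_card M d hd hcard
  obtain ⟨m, B, h1, h2, h3⟩ := M
  obtain rfl : m = n := hM
  obtain ⟨U, hU, hUb⟩ := hred B h1 h3 hdet
  have heven : ∀ i, 2 ∣ (Matrix.transpose U * B * U) i i := by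
    intro i
    rw [cong_apply]
    exact bil_even B h1 h2 _
  let b : T := ⟨Matrix.transpose U * B * U, ⟨cong_symm h1 U, heven, by rw [cong_det B U hU]; exact h3⟩, hUb⟩
  refine ⟨e b, ?_⟩
  apply isom_of_cong B _ U hU
  exact (congrArg Subtype.val (e.symm_apply_apply b)).symm
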